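/- There exists a positive constant C₁ such that Z(x,t) ≤ C₁ · t · (t^{1/(2α)} + ‖x‖_p)^{−2α−4} for all x ∈ ℚ_p⁴ and all t > 0. -/

import Mathlib

open MeasureTheory Real Filter Set

noncomputable section

namespace PadicParabolic

variable (p : ℕ) [Fact p.Prime]

instance : MeasurableSpace ℚ_[p] := borel _
instance : BorelSpace ℚ_[p] := ⟨rfl⟩

/-- The four dimensional vector space over `ℚ_[p]`, with the max-norm
`‖x‖ = max_{1 ≤ i ≤ 4} |x_i|_p`. -/
abbrev V (p : ℕ) [Fact p.Prime] := Fin 4 → ℚ_[p]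

/-- `a` is a quadratic non-residue modulo `p`. -/
def IsQNR (a : ℤ) : Prop := ∀ b : ZMod p, b ^ 2 ≠ (a : ZMod p)

/-- The elliptic quadratic form `f(x) = x₁² − a x₂² − p x₃² + a p x₄²`. -/
def qf (a : ℤ) (x : V p) : ℚ_[p] :=
  x 0 ^ 2 - (a : ℚ_[p]) * x 1 ^ 2 - (p : ℚ_[p]) * x 2 ^ 2 + (a : ℚ_[p]) * (p : ℚ_[p]) * x 3 ^ 2

/-- The dual elliptic quadratic form `f°(ξ) = a p ξ₁² − p ξ₂² − a ξ₃² + ξ₄²`. -/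
def qfc (a : ℤ) (x : V p) : ℚ_[p] :=
  (a : ℚ_[p]) * (p : ℚ_[p]) * x 0 ^ 2 - (p : ℚ_[p]) * x 1 ^ 2 - (a : ℚ_[p]) * x 2 ^ 2 + x 3 ^ 2

/-- `χ` is the standard additive character `χ(y) = exp(2πi {y}_p)` of `ℚ_p`, characterized as
the unique continuous function with `χ(m/pⁿ) = exp(2πi m/pⁿ)`. -/
def IsStdChar (χ : ℚ_[p] → ℂ) : Prop :=
  Continuous χ ∧ ∀ (m : ℤ) (n : ℕ),
    χ ((m : ℚ_[p]) / (p : ℚ_[p]) ^ n) =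
      Complex.exp (2 * (Real.pi : ℂ) * Complex.I * (m : ℂ) / (p : ℂ) ^ n)

/-- The heat kernel `Z(x,t) = ∫_{ℚ_p⁴} χ(ξ·x) e^{−κ t |f°(ξ)|_p^α} d⁴ξ`. -/
def heatZ (μ : Measure (V p)) (χ : ℚ_[p] → ℂ) (a : ℤ) (κ α : ℝ) (x : V p) (t : ℝ) : ℂ :=
  ∫ ξ, χ (∑ i, ξ i * x i) * (Real.exp (-(κ * t * ‖qfc p a ξ‖ ^ α)) : ℂ) ∂μ

section QuadraticForm

variable {p}

theorem IsQNR.norm_intCast {a : ℤ} (ha : IsQNR p a) : ‖(a : ℚ_[p])‖ = 1 := by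
  refine le_antisymm (Padic.norm_int_le_one a) (not_lt.1 fun h => ?_)
  have h' : ‖(a : ℤ_[p])‖ < 1 := by simpa using h
  rw [PadicInt.norm_int_lt_one_iff_dvd] at h'
  exact ha 0 (by simpa using ((ZMod.intCast_zmod_eq_zero_iff_dvd a p).2 h').symm)

theorem IsQNR.norm_sq_sub {a : ℤ} (ha : IsQNR p a) {w : ℚ_[p]} (hw : ‖w‖ ≤ 1) :
    ‖w ^ 2 - a‖ = 1 := by
  let z : ℤ_[p] := ⟨w, hw⟩
  have hz : ‖w ^ 2 - a‖ = ‖z ^ 2 - (a : ℤ_[p])‖ := by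
    rw [PadicInt.norm_def]
    push_cast
    rfl
  rw [hz]
  refine le_antisymm (PadicInt.norm_le_one _) (not_lt.1 fun h => ?_)
  rw [← PadicInt.mem_nonunits, ← IsLocalRing.mem_maximalIdeal, ← PadicInt.ker_toZMod,
    RingHom.mem_ker] at h
  refine ha (PadicInt.toZMod z) ?_
  simpa [sub_eq_zero] using h

theorem IsQNR.norm_sq_sub_mul_sq {a : ℤ} (ha : IsQNR p a) (u v : ℚ_[p]) :
    ‖u ^ 2 - a * v ^ 2‖ = max ‖u‖ ‖v‖ ^ 2 := by
  have hav : ‖-(a * v ^ 2 : ℚ_[p])‖ = ‖v‖ ^ 2 := by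
    rw [norm_neg, norm_mul, ha.norm_intCast, one_mul, norm_pow]
  rcases eq_or_ne v 0 with rfl | hv
  · simp
  by_cases h : ‖u‖ = ‖v‖
  · have hv' : ‖v‖ ≠ 0 := norm_ne_zero_iff.2 hv
    have hw : ‖u / v‖ ≤ 1 := by rw [norm_div, h, div_self hv']
    have key : u ^ 2 - a * v ^ 2 = v ^ 2 * ((u / v) ^ 2 - a) := by field_simp
    rw [key, norm_mul, ha.norm_sq_sub hw, h, max_self, norm_pow, mul_one]
  · have hne : ‖u ^ 2‖ ≠ ‖-(a * v ^ 2 : ℚ_[p])‖ := by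
      rw [hav, norm_pow]
      exact fun h' => h ((pow_left_inj₀ (norm_nonneg _) (norm_nonneg _) two_ne_zero).1 h')
    rw [sub_eq_add_neg, Padic.add_eq_max_of_ne hne, hav, norm_pow]
    rcases le_total ‖u‖ ‖v‖ with h' | h'
    · rw [max_eq_right h', max_eq_right (by gcongr)]
    · rw [max_eq_left h', max_eq_left (by gcongr)]

theorem norm_sq_ne_norm_p_mul_norm_sq {s r : ℚ_[p]} (hr : r ≠ 0) :
    ‖s‖ ^ 2 ≠ (p : ℝ)⁻¹ * ‖r‖ ^ 2 := by
  intro h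
  have hp : 1 < (p : ℝ) := by exact_mod_cast (Fact.out : p.Prime).one_lt
  have hs : s ≠ 0 := by
    rintro rfl
    have : 0 < (p : ℝ)⁻¹ * ‖r‖ ^ 2 := by positivity
    rw [← h] at this
    simp at this
  rw [Padic.norm_eq_zpow_neg_valuation hs, Padic.norm_eq_zpow_neg_valuation hr,
    ← zpow_natCast, ← zpow_natCast, ← zpow_mul, ← zpow_mul, ← zpow_neg_one,
    ← zpow_add₀ (by positivity)] at h
  have := zpow_right_injective₀ (by positivity) hp.ne' h
  push_cast at this
  omega

theorem qfc_eq (a : ℤ) (x : V p) :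
    qfc p a x = (x 3 ^ 2 - a * x 2 ^ 2) + -(p * (x 1 ^ 2 - a * x 0 ^ 2)) := by
  rw [qfc]
  ring

theorem norm_qfc_eq {a : ℤ} (ha : IsQNR p a) (x : V p) :
    ‖qfc p a x‖ = max (max ‖x 3‖ ‖x 2‖ ^ 2) ((p : ℝ)⁻¹ * max ‖x 1‖ ‖x 0‖ ^ 2) := by
  have h1 := ha.norm_sq_sub_mul_sq (x 3) (x 2)
  have h2 : ‖-(p * (x 1 ^ 2 - a * x 0 ^ 2) : ℚ_[p])‖ = (p : ℝ)⁻¹ * max ‖x 1‖ ‖x 0‖ ^ 2 := by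
    rw [norm_neg, norm_mul, Padic.norm_p, ha.norm_sq_sub_mul_sq]
  rw [qfc_eq, ← h2, ← h1]
  by_cases h0 : max ‖x 1‖ ‖x 0‖ = 0
  · rw [h0] at h2
    have : -(p * (x 1 ^ 2 - a * x 0 ^ 2) : ℚ_[p]) = 0 := norm_eq_zero.1 (by simpa using h2)
    rw [this]
    simp
  · apply Padic.add_eq_max_of_ne
    rw [h1, h2]
    obtain ⟨s, hs⟩ : ∃ s : ℚ_[p], ‖s‖ = max ‖x 3‖ ‖x 2‖ := by
      rcases max_choice ‖x 3‖ ‖x 2‖ with h | h <;> exact ⟨_, h.symm⟩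
    obtain ⟨r, hr⟩ : ∃ r : ℚ_[p], ‖r‖ = max ‖x 1‖ ‖x 0‖ := by
      rcases max_choice ‖x 1‖ ‖x 0‖ with h | h <;> exact ⟨_, h.symm⟩
    rw [← hs, ← hr]
    exact norm_sq_ne_norm_p_mul_norm_sq (norm_ne_zero_iff.1 (hr ▸ h0))

theorem V.exists_norm_eq_norm_apply (x : V p) : ∃ j, ‖x‖ = ‖x j‖ := by
  obtain ⟨j, hj⟩ := Finite.exists_max fun i => ‖x i‖
  exact ⟨j, le_antisymm ((pi_norm_le_iff_of_nonneg (norm_nonneg _)).2 hj) (norm_le_pi_norm x j)⟩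

theorem norm_sq_le_norm_qfc {a : ℤ} (ha : IsQNR p a) (x : V p) :
    (p : ℝ)⁻¹ * ‖x‖ ^ 2 ≤ ‖qfc p a x‖ := by
  obtain ⟨j, hj⟩ := V.exists_norm_eq_norm_apply x
  have hp : (p : ℝ)⁻¹ ≤ 1 := inv_le_one_of_one_le₀
    (by exact_mod_cast (Fact.out : p.Prime).one_lt.le)
  rw [hj, norm_qfc_eq ha]
  have hp0 : 0 ≤ (p : ℝ)⁻¹ := by positivity
  have hlow : ∀ y m : ℝ, 0 ≤ y → y ≤ m → (p : ℝ)⁻¹ * y ^ 2 ≤ m ^ 2 := fun y m hy hm =>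
    (mul_le_of_le_one_left (sq_nonneg y) hp).trans (by gcongr)
  fin_cases j
  · exact le_max_of_le_right (by gcongr; exact le_max_right _ _)
  · exact le_max_of_le_right (by gcongr; exact le_max_left _ _)
  · exact le_max_of_le_left (hlow _ _ (norm_nonneg _) (le_max_right _ _))
  · exact le_max_of_le_left (hlow _ _ (norm_nonneg _) (le_max_left _ _))

theorem norm_qfc_le {a : ℤ} (ha : IsQNR p a) (x : V p) : ‖qfc p a x‖ ≤ ‖x‖ ^ 2 := by
  have hp : (p : ℝ)⁻¹ ≤ 1 := inv_le_one_of_one_le₀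
    (by exact_mod_cast (Fact.out : p.Prime).one_lt.le)
  have hx := norm_le_pi_norm x
  rw [norm_qfc_eq ha]
  refine max_le ?_ ((mul_le_of_le_one_left (by positivity) hp).trans ?_) <;>
  · gcongr
    exact max_le (hx _) (hx _)

theorem norm_mul_two_mul_add_le {c x y : ℚ_[p]} {X Y : ℝ} (hc : ‖c‖ ≤ 1)
    (hx : ‖x‖ ≤ X) (hy : ‖y‖ ≤ Y) (hYX : Y ≤ X) : ‖c * (y * (2 * x + y))‖ ≤ Y * X := by
  have h2 : ‖(2 : ℚ_[p])‖ ≤ 1 := by simpa using Padic.norm_int_le_one (p := p) 2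
  have h : ‖2 * x + y‖ ≤ X := by
    refine (Padic.nonarchimedean _ _).trans (max_le ?_ (hy.trans hYX))
    rw [norm_mul]
    exact (mul_le_of_le_one_left (norm_nonneg _) h2).trans hx
  rw [norm_mul, norm_mul]
  have hY : 0 ≤ Y := (norm_nonneg _).trans hy
  calc ‖c‖ * (‖y‖ * ‖2 * x + y‖) ≤ ‖y‖ * ‖2 * x + y‖ :=
        mul_le_of_le_one_left (by positivity) hc
    _ ≤ Y * X := by gcongr

theorem norm_qfc_add_of_lt {a : ℤ} (ha : IsQNR p a) {x y : V p} (h : p * ‖y‖ < ‖x‖) :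
    ‖qfc p a (x + y)‖ = ‖qfc p a x‖ := by
  have hp1 : 1 ≤ (p : ℝ) := by exact_mod_cast (Fact.out : p.Prime).one_lt.le
  have hp0 : (0 : ℝ) < p := by positivity
  have hyx : ‖y‖ ≤ ‖x‖ := (le_mul_of_one_le_left (norm_nonneg y) hp1).trans h.le
  have hx0 : 0 < ‖x‖ := lt_of_le_of_lt (by positivity) h
  have hpn : ‖(p : ℚ_[p])‖ ≤ 1 := by simpa using Padic.norm_int_le_one (p := p) p
  have han := ha.norm_intCast.le
  have hap : ‖(a * p : ℚ_[p])‖ ≤ 1 := by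
    simpa using Padic.norm_int_le_one (p := p) (a * p)
  have term : ∀ (c : ℚ_[p]) (i : Fin 4), ‖c‖ ≤ 1 →
      ‖c * (y i * (2 * x i + y i))‖ ≤ ‖y‖ * ‖x‖ := fun c i hc =>
    norm_mul_two_mul_add_le hc (norm_le_pi_norm x i) (norm_le_pi_norm y i) hyx
  let d := qfc p a (x + y) - qfc p a x
  have hd : d = ((a * p) * (y 0 * (2 * x 0 + y 0)) + (-p) * (y 1 * (2 * x 1 + y 1))) +
      ((-a) * (y 2 * (2 * x 2 + y 2)) + 1 * (y 3 * (2 * x 3 + y 3))) := by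
    simp only [d, qfc, Pi.add_apply]
    ring
  have hdn : ‖d‖ ≤ ‖y‖ * ‖x‖ := by
    rw [hd]
    refine (Padic.nonarchimedean _ _).trans (max_le ?_ ?_) <;>
    refine (Padic.nonarchimedean _ _).trans (max_le (term _ _ ?_) (term _ _ ?_))
    · exact hap
    · rwa [norm_neg]
    · rwa [norm_neg]
    · simp
  have hlt : ‖d‖ < ‖qfc p a x‖ := by
    refine hdn.trans_lt (lt_of_lt_of_le ?_ (norm_sq_le_norm_qfc ha x))
    rw [sq, ← mul_assoc]
    gcongr
    rw [lt_inv_mul_iff₀ hp0]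
    exact h
  have : qfc p a (x + y) = qfc p a x + d := by simp [d]
  rw [this, Padic.add_eq_max_of_ne hlt.ne', max_eq_left hlt.le]

theorem norm_qfc_add_le {a : ℤ} (ha : IsQNR p a) {x y : V p} (h : ‖x‖ ≤ p * ‖y‖) :
    ‖qfc p a (x + y)‖ ≤ (p * ‖y‖) ^ 2 := by
  have hp1 : 1 ≤ (p : ℝ) := by exact_mod_cast (Fact.out : p.Prime).one_lt.le
  have hy : ‖y‖ ≤ p * ‖y‖ := le_mul_of_one_le_left (norm_nonneg y) hp1
  refine (norm_qfc_le ha _).trans ?_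
  gcongr
  exact (IsUltrametricDist.norm_add_le_max x y).trans (max_le h hy)

end QuadraticForm

section Character

variable {p}

theorem mem_closure_intCast_div_pow (y : ℚ_[p]) :
    y ∈ closure {z : ℚ_[p] | ∃ (m : ℤ) (n : ℕ), z = m / p ^ n} := by
  obtain ⟨n, z, hz⟩ : ∃ (n : ℕ) (z : ℤ_[p]), y = z / p ^ n := by
    have hp1 : 1 < (p : ℝ) := by exact_mod_cast (Fact.out : p.Prime).one_lt
    obtain ⟨n, hn⟩ := pow_unbounded_of_one_lt ‖y‖ hp1
    have hp : (p : ℚ_[p]) ≠ 0 := by exact_mod_cast (Fact.out : p.Prime).ne_zero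
    refine ⟨n, ⟨y * p ^ n, ?_⟩, ?_⟩
    · rw [norm_mul, norm_pow, Padic.norm_p, inv_pow, ← div_eq_mul_inv]
      exact div_le_one_of_le₀ hn.le (by positivity)
    · field_simp
  rw [hz]
  refine map_mem_closure (f := fun z : ℤ_[p] => (z : ℚ_[p]) / p ^ n) (by fun_prop)
    (PadicInt.denseRange_intCast z) ?_
  rintro _ ⟨m, rfl⟩
  exact ⟨m, n, by simp⟩

variable {χ : ℚ_[p] → ℂ}

theorem IsStdChar.norm_eq_one (hχ : IsStdChar p χ) (y : ℚ_[p]) : ‖χ y‖ = 1 := by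
  have hc : IsClosed {z | ‖χ z‖ = 1} := isClosed_eq hχ.1.norm continuous_const
  refine hc.closure_subset_iff.2 ?_ (mem_closure_intCast_div_pow y)
  rintro _ ⟨m, n, rfl⟩
  have : (2 * (Real.pi : ℂ) * Complex.I * (m : ℂ) / (p : ℂ) ^ n) =
      ((2 * Real.pi * m / p ^ n : ℝ) : ℂ) * Complex.I := by
    push_cast
    ring
  rw [mem_ofPred_eq, hχ.2, this, Complex.norm_exp_ofReal_mul_I]

theorem IsStdChar.add_inv_p (hχ : IsStdChar p χ) (y : ℚ_[p]) :
    χ (y + (p : ℚ_[p])⁻¹) = χ (p : ℚ_[p])⁻¹ * χ y := by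
  have hp : (p : ℚ_[p]) ≠ 0 := by exact_mod_cast (Fact.out : p.Prime).ne_zero
  have hpC : (p : ℂ) ≠ 0 := by exact_mod_cast (Fact.out : p.Prime).ne_zero
  have hc : IsClosed {z | χ (z + (p : ℚ_[p])⁻¹) = χ (p : ℚ_[p])⁻¹ * χ z} := by
    have := hχ.1
    exact isClosed_eq (by fun_prop) (by fun_prop)
  refine hc.closure_subset_iff.2 ?_ (mem_closure_intCast_div_pow y)
  rintro _ ⟨m, n, rfl⟩
  have h1 : (m : ℚ_[p]) / p ^ n + (p : ℚ_[p])⁻¹ =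
      ((m * p + p ^ n : ℤ) : ℚ_[p]) / p ^ (n + 1) := by
    push_cast
    field_simp
    ring
  have h2 : (p : ℚ_[p])⁻¹ = ((1 : ℤ) : ℚ_[p]) / p ^ 1 := by simp
  rw [mem_ofPred_eq, h1, h2, hχ.2, hχ.2, hχ.2, ← Complex.exp_add]
  congr 1
  push_cast
  field_simp
  ring

theorem IsStdChar.apply_inv_p_ne_one (hχ : IsStdChar p χ) : χ (p : ℚ_[p])⁻¹ ≠ 1 := by
  have h2 : (p : ℚ_[p])⁻¹ = ((1 : ℤ) : ℚ_[p]) / p ^ 1 := by simp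
  have hpC : (p : ℂ) ≠ 0 := by exact_mod_cast (Fact.out : p.Prime).ne_zero
  rw [h2, hχ.2]
  have := Complex.isPrimitiveRoot_exp p (Fact.out : p.Prime).ne_zero
  simpa using this.ne_one (Fact.out : p.Prime).one_lt

end Character

section BallMeasure

variable {p}

theorem V.norm_le_zpow_iff (x : V p) (k : ℤ) : ‖x‖ ≤ (p : ℝ) ^ k ↔ ‖x‖ < (p : ℝ) ^ (k + 1) := by
  have hp : 0 < (p : ℝ) := by exact_mod_cast (Fact.out : p.Prime).pos
  rw [pi_norm_le_iff_of_nonneg (by positivity), pi_norm_lt_iff (by positivity)]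
  simp_rw [Padic.norm_le_pow_iff_norm_lt_pow_add_one]

theorem exists_natCast_norm_sub_le {k : ℤ} {y : ℚ_[p]} (hy : ‖y‖ ≤ (p : ℝ) ^ (k + 1)) :
    ∃ n : Fin p, ‖y - (n : ℕ) * (p : ℚ_[p]) ^ (-(k + 1))‖ ≤ (p : ℝ) ^ k := by
  have hp : 0 < (p : ℝ) := by exact_mod_cast (Fact.out : p.Prime).pos
  have hpp : (p : ℚ_[p]) ≠ 0 := by exact_mod_cast (Fact.out : p.Prime).ne_zero
  have hz : ‖y * (p : ℚ_[p]) ^ (k + 1)‖ ≤ 1 := by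
    rw [norm_mul, Padic.norm_p_zpow, zpow_neg, ← div_eq_mul_inv]
    exact div_le_one_of_le₀ hy (by positivity)
  let z : ℤ_[p] := ⟨_, hz⟩
  refine ⟨⟨z.zmodRepr, PadicInt.zmodRepr_lt_p z⟩, ?_⟩
  have h := PadicInt.norm_sub_zmodRepr_lt_one z
  rw [PadicInt.norm_def] at h
  simp only [PadicInt.coe_sub, PadicInt.coe_natCast] at h
  have heq : y - (z.zmodRepr : ℕ) * (p : ℚ_[p]) ^ (-(k + 1)) =
      (z - z.zmodRepr) * (p : ℚ_[p]) ^ (-(k + 1)) := by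
    simp only [z, sub_mul, mul_assoc, zpow_neg]
    rw [mul_inv_cancel₀ (zpow_ne_zero _ hpp), mul_one]
  rw [Padic.norm_le_pow_iff_norm_lt_pow_add_one, heq, norm_mul, Padic.norm_p_zpow, neg_neg]
  exact mul_lt_of_lt_one_left (by positivity) h

theorem Fin.eq_of_norm_natCast_sub_lt_one {m n : Fin p}
    (h : ‖((m : ℕ) - (n : ℕ) : ℚ_[p])‖ < 1) : m = n := by
  have h' : ‖(((m : ℕ) - (n : ℕ) : ℤ) : ℤ_[p])‖ < 1 := by
    rw [PadicInt.norm_def]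
    simpa using h
  rw [PadicInt.norm_int_lt_one_iff_dvd] at h'
  have := Int.eq_zero_of_abs_lt_dvd h' (by rw [abs_lt]; omega)
  omega

variable (μ : Measure (V p)) [μ.IsAddHaarMeasure]

theorem measure_norm_le_zpow_add_one (k : ℤ) :
    μ {x : V p | ‖x‖ ≤ (p : ℝ) ^ (k + 1)} = (p : ENNReal) ^ 4 * μ {x : V p | ‖x‖ ≤ (p : ℝ) ^ k} := by
  have hp : 1 < (p : ℝ) := by exact_mod_cast (Fact.out : p.Prime).one_lt
  let v : (Fin 4 → Fin p) → V p := fun c i => (c i : ℕ) * (p : ℚ_[p]) ^ (-(k + 1))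
  let B : Set (V p) := {x | ‖x‖ ≤ (p : ℝ) ^ k}
  have hB : MeasurableSet B := (isClosed_le continuous_norm continuous_const).measurableSet
  have hv : ∀ c, ‖v c‖ ≤ (p : ℝ) ^ (k + 1) := fun c => by
    refine (pi_norm_le_iff_of_nonneg (by positivity)).2 fun i => ?_
    rw [norm_mul, Padic.norm_p_zpow, neg_neg]
    refine mul_le_of_le_one_left (by positivity) ?_
    simpa using Padic.norm_int_le_one (p := p) (c i : ℕ)
  have hU : {x : V p | ‖x‖ ≤ (p : ℝ) ^ (k + 1)} = ⋃ c, (fun x => x - v c) ⁻¹' B := by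
    ext x
    simp only [mem_ofPred_eq, mem_iUnion, mem_preimage, B]
    constructor
    · intro hx
      choose c hc using fun i => exists_natCast_norm_sub_le ((norm_le_pi_norm x i).trans hx)
      exact ⟨c, (pi_norm_le_iff_of_nonneg (by positivity)).2 hc⟩
    · rintro ⟨c, hc⟩
      rw [← sub_add_cancel x (v c)]
      refine (IsUltrametricDist.norm_add_le_max _ _).trans (max_le (hc.trans ?_) (hv c))
      exact zpow_le_zpow_right₀ hp.le (by omega)
  rw [hU, measure_iUnion]
  · have : ∀ c, μ ((fun x => x - v c) ⁻¹' B) = μ B := fun c => by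
      simp_rw [sub_eq_add_neg]
      exact measure_preimage_add_right μ _ _
    simp_rw [this]
    rw [tsum_fintype, Finset.sum_const, Finset.card_univ, nsmul_eq_mul]
    simp [B]
  · intro c d hcd
    refine Set.disjoint_left.2 fun x hc hd => hcd (funext fun i => ?_)
    have h1 : ‖v c - v d‖ ≤ (p : ℝ) ^ k := by
      have : v c - v d = (x - v d) + -(x - v c) := by abel
      rw [this]
      refine (IsUltrametricDist.norm_add_le_max _ _).trans (max_le hd ?_)
      rw [norm_neg]
      exact hc
    rw [V.norm_le_zpow_iff] at h1
    have h2 := (norm_le_pi_norm _ i).trans_lt h1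
    simp only [Pi.sub_apply, v, ← sub_mul] at h2
    rw [norm_mul, Padic.norm_p_zpow, neg_neg] at h2
    exact Fin.eq_of_norm_natCast_sub_lt_one
      ((mul_lt_iff_lt_one_left (by positivity)).1 h2)
  · exact fun c => (measurable_sub_const _) hB

theorem measure_norm_le_zpow (hμ : μ {x : V p | ‖x‖ ≤ 1} = 1) (k : ℤ) :
    μ {x : V p | ‖x‖ ≤ (p : ℝ) ^ k} = ENNReal.ofReal (((p : ℝ) ^ k) ^ 4) := by
  have hp : 0 < (p : ℝ) := by exact_mod_cast (Fact.out : p.Prime).pos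
  have hpE : (p : ENNReal) ^ 4 = ENNReal.ofReal ((p : ℝ) ^ 4) := by
    rw [ENNReal.ofReal_pow hp.le, ENNReal.ofReal_natCast]
  have step : ∀ k : ℤ, ENNReal.ofReal (((p : ℝ) ^ (k + 1)) ^ 4) =
      (p : ENNReal) ^ 4 * ENNReal.ofReal (((p : ℝ) ^ k) ^ 4) := fun k => by
    rw [hpE, ← ENNReal.ofReal_mul (by positivity), zpow_add_one₀ hp.ne', mul_pow, mul_comm]
  have iff : ∀ k : ℤ, μ {x : V p | ‖x‖ ≤ (p : ℝ) ^ (k + 1)} =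
      ENNReal.ofReal (((p : ℝ) ^ (k + 1)) ^ 4) ↔
      μ {x : V p | ‖x‖ ≤ (p : ℝ) ^ k} = ENNReal.ofReal (((p : ℝ) ^ k) ^ 4) := fun k => by
    rw [step, measure_norm_le_zpow_add_one]
    refine ENNReal.mul_right_inj ?_ ?_ <;> rw [hpE]
    · simpa using hp.ne'
    · exact ENNReal.ofReal_ne_top
  induction k with
  | zero => simpa using hμ
  | succ n ih => exact (iff _).2 ih
  | pred n ih =>
    rw [← iff]
    simpa using ih

theorem measure_norm_le (hμ : μ {x : V p | ‖x‖ ≤ 1} = 1) {R : ℝ} (hR : 0 < R) :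
    μ {x : V p | ‖x‖ ≤ R} ≤ ENNReal.ofReal (R ^ 4) := by
  have hp : 1 < (p : ℝ) := by exact_mod_cast (Fact.out : p.Prime).one_lt
  obtain ⟨k, hk1, hk2⟩ := exists_mem_Ico_zpow hR hp
  calc μ {x : V p | ‖x‖ ≤ R} ≤ μ {x : V p | ‖x‖ ≤ (p : ℝ) ^ k} :=
        measure_mono fun x hx => (V.norm_le_zpow_iff x k).2 (lt_of_le_of_lt hx hk2)
    _ = ENNReal.ofReal (((p : ℝ) ^ k) ^ 4) := measure_norm_le_zpow μ hμ k
    _ ≤ ENNReal.ofReal (R ^ 4) := by gcongr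

theorem measure_norm_pow_four_le (hμ : μ {x : V p | ‖x‖ ≤ 1} = 1) {M : ℝ} (hM : 0 < M) :
    μ {x : V p | ‖x‖ ^ 4 ≤ M} ≤ ENNReal.ofReal M := by
  have hR : (M ^ (1 / 4 : ℝ)) ^ 4 = M := by
    rw [← Real.rpow_natCast, ← Real.rpow_mul hM.le]
    norm_num
  calc μ {x : V p | ‖x‖ ^ 4 ≤ M} ≤ μ {x : V p | ‖x‖ ≤ M ^ (1 / 4 : ℝ)} := by
        refine measure_mono fun x hx => ?_
        refine (pow_le_pow_iff_left₀ (norm_nonneg _) (by positivity) four_ne_zero).1 ?_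
        rw [hR]
        exact hx
    _ ≤ ENNReal.ofReal M := (measure_norm_le μ hμ (by positivity)).trans_eq (by rw [hR])

end BallMeasure

section HeatKernel

variable {p}

theorem continuous_exp_neg_norm_qfc_rpow (a : ℤ) {α : ℝ} (hα : 0 < α) (c : ℝ) :
    Continuous fun ξ : V p => Real.exp (-(c * ‖qfc p a ξ‖ ^ α)) := by
  have : Continuous (qfc p a) := by
    unfold qfc
    fun_prop
  exact Real.continuous_exp.comp
    (continuous_const.mul (this.norm.rpow_const fun _ => Or.inr hα.le)).neg

theorem norm_pow_four_le_of_lt_exp {a : ℤ} (ha : IsQNR p a) {α c u : ℝ} (hα : 0 < α) (hc : 0 < c)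
    (hu : 0 < u) {ξ : V p} (h : u < Real.exp (-(c * ‖qfc p a ξ‖ ^ α))) :
    ‖ξ‖ ^ 4 ≤ (p ^ 2 * (4 / α) ^ (2 / α) * c ^ (-(2 / α))) * u ^ (-(1 / 2) : ℝ) := by
  have hp : 0 < (p : ℝ) := by exact_mod_cast (Fact.out : p.Prime).pos
  set N := ‖qfc p a ξ‖
  have hN : 0 ≤ N := norm_nonneg _
  have h1 : c * N ^ α ≤ u⁻¹ ^ (α / 4) / (α / 4) := by
    refine le_trans ?_ (Real.log_le_rpow_div (by positivity) (by positivity))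
    rw [Real.log_inv]
    linarith [(Real.log_lt_iff_lt_exp hu).2 h]
  have h2 : N ^ α ≤ (4 / α) * c⁻¹ * u⁻¹ ^ (α / 4) := by
    rw [← le_div_iff₀' hc] at h1
    refine h1.trans_eq ?_
    field_simp
  have h3 : N ^ 2 ≤ ((4 / α) * c⁻¹ * u⁻¹ ^ (α / 4)) ^ (2 / α) := by
    have : N ^ 2 = (N ^ α) ^ (2 / α) := by
      rw [← Real.rpow_mul hN, mul_div_cancel₀ _ hα.ne', Real.rpow_two]
    rw [this]
    gcongr
  have h4 : ‖ξ‖ ^ 4 ≤ p ^ 2 * N ^ 2 := by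
    have := norm_sq_le_norm_qfc ha ξ
    rw [inv_mul_le_iff₀ hp] at this
    calc ‖ξ‖ ^ 4 = (‖ξ‖ ^ 2) ^ 2 := by ring
      _ ≤ (p * N) ^ 2 := by gcongr
      _ = p ^ 2 * N ^ 2 := by ring
  have h5 : ((4 / α) * c⁻¹ * u⁻¹ ^ (α / 4)) ^ (2 / α) =
      (4 / α) ^ (2 / α) * c ^ (-(2 / α)) * u ^ (-(1 / 2) : ℝ) := by
    rw [Real.mul_rpow (by positivity) (by positivity), Real.mul_rpow (by positivity) (by positivity),
      ← Real.rpow_mul (by positivity), Real.inv_rpow hc.le, Real.inv_rpow hu.le,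
      Real.rpow_neg hc.le, Real.rpow_neg hu.le]
    congr 3
    field_simp
    norm_num
  calc ‖ξ‖ ^ 4 ≤ p ^ 2 * N ^ 2 := h4
    _ ≤ p ^ 2 * ((4 / α) ^ (2 / α) * c ^ (-(2 / α)) * u ^ (-(1 / 2) : ℝ)) := by
        rw [← h5]
        gcongr
    _ = _ := by ring

variable (μ : Measure (V p)) [μ.IsAddHaarMeasure]

theorem lintegral_exp_neg_norm_qfc_rpow_le (hμ : μ {x : V p | ‖x‖ ≤ 1} = 1) {a : ℤ}
    (ha : IsQNR p a) {α c : ℝ} (hα : 0 < α) (hc : 0 < c) :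
    ∫⁻ ξ, ENNReal.ofReal (Real.exp (-(c * ‖qfc p a ξ‖ ^ α))) ∂μ ≤
      ENNReal.ofReal (p ^ 2 * (4 / α) ^ (2 / α) * c ^ (-(2 / α))) *
        ∫⁻ u in Ioo (0 : ℝ) 1, ENNReal.ofReal (u ^ (-(1 / 2) : ℝ)) := by
  have hp : 0 < (p : ℝ) := by exact_mod_cast (Fact.out : p.Prime).pos
  rw [lintegral_eq_lintegral_meas_lt μ (ae_of_all _ fun _ => (Real.exp_pos _).le)
    (continuous_exp_neg_norm_qfc_rpow a hα c).aemeasurable,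
    ← lintegral_const_mul' _ _ ENNReal.ofReal_ne_top, ← lintegral_indicator measurableSet_Ioi,
    ← lintegral_indicator measurableSet_Ioo]
  refine lintegral_mono fun u => ?_
  by_cases hu : 0 < u
  · rw [indicator_of_mem (show u ∈ Ioi 0 from hu)]
    by_cases hu1 : u < 1
    · rw [indicator_of_mem (show u ∈ Ioo 0 1 from ⟨hu, hu1⟩), ← ENNReal.ofReal_mul (by positivity)]
      refine le_trans (measure_mono fun ξ hξ => ?_)
        (measure_norm_pow_four_le μ hμ (by positivity))
      exact norm_pow_four_le_of_lt_exp ha hα hc hu hξ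
    · have : {ξ : V p | u < Real.exp (-(c * ‖qfc p a ξ‖ ^ α))} = ∅ := by
        refine eq_empty_of_forall_notMem fun ξ hξ => hu1 (lt_of_lt_of_le hξ ?_)
        rw [Real.exp_le_one_iff, neg_nonpos]
        positivity
      rw [this, measure_empty]
      exact zero_le
  · rw [indicator_of_notMem (show u ∉ Ioi 0 from hu)]
    exact zero_le

theorem lintegral_Ioo_rpow_lt_top :
    ∫⁻ u in Ioo (0 : ℝ) 1, ENNReal.ofReal (u ^ (-(1 / 2) : ℝ)) < ⊤ := by
  have h : IntegrableOn (fun u : ℝ => u ^ (-(1 / 2) : ℝ)) (Ioo 0 1) :=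
    (intervalIntegrable_iff_integrableOn_Ioo_of_le zero_le_one).1
      (intervalIntegral.intervalIntegrable_rpow' (by norm_num))
  exact h.lintegral_lt_top

variable {χ : ℚ_[p] → ℂ}

theorem norm_heatZ_integrand (hχ : IsStdChar p χ) (y : ℚ_[p]) (r : ℝ) :
    ‖χ y * (Real.exp r : ℂ)‖ = Real.exp r := by
  rw [norm_mul, hχ.norm_eq_one, one_mul, Complex.norm_real, Real.norm_of_nonneg (Real.exp_pos _).le]

theorem exists_norm_heatZ_le_rpow (hμ : μ {x : V p | ‖x‖ ≤ 1} = 1) (hχ : IsStdChar p χ) {a : ℤ}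
    (ha : IsQNR p a) {κ α : ℝ} (hκ : 0 < κ) (hα : 0 < α) :
    ∃ C : ℝ, 0 ≤ C ∧ ∀ (x : V p) (t : ℝ), 0 < t →
      ‖heatZ p μ χ a κ α x t‖ ≤ C * t ^ (-(2 / α)) := by
  set A := ∫⁻ u in Ioo (0 : ℝ) 1, ENNReal.ofReal (u ^ (-(1 / 2) : ℝ))
  have hA : A ≠ ⊤ := lintegral_Ioo_rpow_lt_top.ne
  refine ⟨p ^ 2 * (4 / α) ^ (2 / α) * κ ^ (-(2 / α)) * A.toReal, by positivity, fun x t ht => ?_⟩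
  have h : ‖heatZ p μ χ a κ α x t‖ₑ ≤
      ENNReal.ofReal (p ^ 2 * (4 / α) ^ (2 / α) * (κ * t) ^ (-(2 / α))) * A := by
    refine (enorm_integral_le_lintegral_enorm _).trans
      (le_trans (lintegral_congr fun ξ => ?_).le
        (lintegral_exp_neg_norm_qfc_rpow_le μ hμ ha hα (mul_pos hκ ht)))
    rw [← ofReal_norm, norm_heatZ_integrand hχ]
  rw [← ofReal_norm, ← ENNReal.ofReal_toReal hA, ← ENNReal.ofReal_mul (by positivity),
    ENNReal.ofReal_le_ofReal_iff (by positivity), Real.mul_rpow hκ.le ht.le] at h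
  exact h.trans_eq (by ring)

theorem norm_exp_neg_sub_exp_neg_le {r s M : ℝ} (hr : 0 ≤ r) (hs : 0 ≤ s) (hrM : r ≤ M)
    (hsM : s ≤ M) : ‖((Real.exp (-r) : ℂ) - (Real.exp (-s) : ℂ))‖ ≤ M := by
  rw [← Complex.ofReal_sub, Complex.norm_real, Real.norm_eq_abs, abs_le]
  have h1 : Real.exp (-r) ≤ 1 := by simpa using hr
  have h2 : Real.exp (-s) ≤ 1 := by simpa using hs
  constructor <;> linarith [Real.one_sub_le_exp_neg r, Real.one_sub_le_exp_neg s]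

theorem norm_one_sub_mul_norm_heatZ_le (hμ : μ {x : V p | ‖x‖ ≤ 1} = 1) (hχ : IsStdChar p χ)
    {a : ℤ} (ha : IsQNR p a) {κ α : ℝ} (hκ : 0 < κ) (hα : 0 < α) {x : V p} (hx : x ≠ 0) {t : ℝ}
    (ht : 0 < t) :
    ‖1 - χ (p : ℚ_[p])⁻¹‖ * ‖heatZ p μ χ a κ α x t‖ ≤
      κ * t * ((p ^ 2 / ‖x‖) ^ 2) ^ α * (p ^ 2 / ‖x‖) ^ 4 := by
  have hp : 0 < (p : ℝ) := by exact_mod_cast (Fact.out : p.Prime).pos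
  have hx0 : 0 < ‖x‖ := norm_pos_iff.2 hx
  set ω := χ (p : ℚ_[p])⁻¹
  set F : V p → ℂ := fun ξ =>
    χ (∑ i, ξ i * x i) * (Real.exp (-(κ * t * ‖qfc p a ξ‖ ^ α)) : ℂ) with hF
  have hZ : heatZ p μ χ a κ α x t = ∫ ξ, F ξ ∂μ := rfl
  by_cases hint : Integrable F μ
  swap
  · rw [hZ, integral_undef hint, norm_zero, mul_zero]
    positivity
  obtain ⟨j, hj⟩ := V.exists_norm_eq_norm_apply x
  have hxj : x j ≠ 0 := norm_ne_zero_iff.1 (hj ▸ hx0.ne')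
  let η : V p := Pi.single j ((p : ℚ_[p])⁻¹ / x j)
  have hη : p * ‖η‖ = p ^ 2 / ‖x‖ := by
    rw [Pi.norm_single, norm_div, norm_inv, Padic.norm_p, inv_inv, ← hj]
    ring
  have hηx : ∑ i, η i * x i = (p : ℚ_[p])⁻¹ := by
    rw [Finset.sum_eq_single j]
    · simp [η, hxj]
    · intro i _ hi
      simp [η, hi]
    · simp
  have hshift : ∀ ξ, ω * F ξ - F (ξ + η) = (ω * χ (∑ i, ξ i * x i)) *
      ((Real.exp (-(κ * t * ‖qfc p a ξ‖ ^ α)) : ℂ) -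
        (Real.exp (-(κ * t * ‖qfc p a (ξ + η)‖ ^ α)) : ℂ)) := fun ξ => by
    simp only [hF, Pi.add_apply, add_mul, Finset.sum_add_distrib, hηx, hχ.add_inv_p]
    ring
  set r := (p : ℝ) ^ 2 / ‖x‖ with hr
  have hr0 : 0 < r := by positivity
  let B : Set (V p) := {ξ | ‖ξ‖ ≤ r}
  have hBμ : μ B ≤ ENNReal.ofReal (r ^ 4) := measure_norm_le μ hμ hr0
  have hsupp : ∀ ξ ∉ B, ω * F ξ - F (ξ + η) = 0 := fun ξ hξ => by
    rw [hshift, norm_qfc_add_of_lt ha (by rw [hη]; exact not_le.1 hξ), sub_self, mul_zero]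
  have hbound : ∀ ξ ∈ B, ‖ω * F ξ - F (ξ + η)‖ ≤ κ * t * (r ^ 2) ^ α := fun ξ hξ => by
    rw [hshift, norm_mul, norm_mul, hχ.norm_eq_one, hχ.norm_eq_one, one_mul, one_mul]
    have h1 : ‖qfc p a ξ‖ ≤ r ^ 2 := (norm_qfc_le ha ξ).trans (by gcongr; exact hξ)
    have h2 : ‖qfc p a (ξ + η)‖ ≤ r ^ 2 := by
      rw [← hη]
      exact norm_qfc_add_le ha (by rw [hη]; exact hξ)
    refine norm_exp_neg_sub_exp_neg_le (by positivity) (by positivity) ?_ ?_ <;> gcongr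
  have hdiff : (ω - 1) * heatZ p μ χ a κ α x t = ∫ ξ, (ω * F ξ - F (ξ + η)) ∂μ := by
    rw [integral_sub (hint.const_mul ω) (hint.comp_add_right η), integral_const_mul,
      integral_add_right_eq_self, hZ]
    ring
  rw [norm_sub_rev, ← norm_mul, hdiff, ← setIntegral_eq_integral_of_forall_compl_eq_zero hsupp]
  refine (norm_setIntegral_le_of_norm_le_const (hBμ.trans_lt ENNReal.ofReal_lt_top) hbound).trans ?_
  gcongr
  exact ENNReal.toReal_le_of_le_ofReal (by positivity) hBμ

end HeatKernel

/-- there is `C₁ > 0` with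
`Z(x,t) ≤ C₁ t (t^{1/(2α)} + ‖x‖_p)^{−2α−4}` for all `x ∈ ℚ_p⁴`, `t > 0`. -/
theorem statement4
    (hp : p ≠ 2) (a : ℤ) (ha : IsQNR p a)
    (μ : Measure (V p)) [μ.IsAddHaarMeasure] (hμ : μ {x : V p | ‖x‖ ≤ 1} = 1)
    (χ : ℚ_[p] → ℂ) (hχ : IsStdChar p χ)
    (κ α : ℝ) (hκ : 0 < κ) (hα : 0 < α) :
    ∃ C₁ : ℝ, 0 < C₁ ∧ ∀ (x : V p) (t : ℝ), 0 < t →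
      ‖heatZ p μ χ a κ α x t‖ ≤ C₁ * t * (t ^ (1 / (2 * α)) + ‖x‖) ^ (-(2 * α) - 4) := by
  have hp0 : 0 < (p : ℝ) := by exact_mod_cast (Fact.out : p.Prime).pos
  obtain ⟨C, hC0, hC⟩ := exists_norm_heatZ_le_rpow μ hμ hχ ha hκ hα
  set δ := ‖1 - χ (p : ℚ_[p])⁻¹‖
  have hδ : 0 < δ := norm_pos_iff.2 (sub_ne_zero.2 hχ.apply_inv_p_ne_one.symm)
  let D : ℝ := δ⁻¹ * (κ * ((p : ℝ) ^ 2) ^ (2 * α + 4))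
  have hD : 0 < D := by positivity
  have far : ∀ (x : V p) (t : ℝ), 0 < t → x ≠ 0 →
      ‖heatZ p μ χ a κ α x t‖ ≤ D * t * ‖x‖ ^ (-(2 * α) - 4) := fun x t ht hx => by
    have hx0 : 0 < ‖x‖ := norm_pos_iff.2 hx
    have h := norm_one_sub_mul_norm_heatZ_le μ hμ hχ ha hκ hα hx ht
    rw [← le_inv_mul_iff₀ hδ] at h
    refine h.trans_eq ?_
    have hr : 0 < (p : ℝ) ^ 2 / ‖x‖ := by positivity
    have e1 : (((p : ℝ) ^ 2 / ‖x‖) ^ 2) ^ α * ((p : ℝ) ^ 2 / ‖x‖) ^ 4 =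
        ((p : ℝ) ^ 2 / ‖x‖) ^ (2 * α + 4) := by
      rw [← Real.rpow_natCast, ← Real.rpow_natCast _ 4, ← Real.rpow_mul hr.le,
        ← Real.rpow_add hr]
      norm_num
    have e2 : ‖x‖ ^ (-(2 * α) - 4) = (‖x‖ ^ (2 * α + 4))⁻¹ := by
      rw [← Real.rpow_neg hx0.le]
      ring_nf
    rw [mul_assoc, e1, Real.div_rpow (by positivity) hx0.le, e2]
    simp only [D]
    ring
  have near : ∀ t : ℝ, 0 < t →
      t ^ (-(2 / α)) = t * (t ^ (1 / (2 * α))) ^ (-(2 * α) - 4) := fun t ht => by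
    rw [← Real.rpow_mul ht.le]
    nth_rw 2 [← Real.rpow_one t]
    rw [← Real.rpow_add ht]
    congr 1
    field_simp
    ring
  refine ⟨2 ^ (2 * α + 4) * (C + D), by positivity, fun x t ht => ?_⟩
  set τ := t ^ (1 / (2 * α))
  have hτ : 0 < τ := by positivity
  have compare : ∀ {K s : ℝ}, 0 ≤ K → K ≤ C + D → 0 < s → τ + ‖x‖ ≤ 2 * s →
      K * t * s ^ (-(2 * α) - 4) ≤
        2 ^ (2 * α + 4) * (C + D) * t * (τ + ‖x‖) ^ (-(2 * α) - 4) := by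
    intro K s hK hKCD hs hle
    have h1 : s ^ (-(2 * α) - 4) = 2 ^ (2 * α + 4) * (2 * s) ^ (-(2 * α) - 4) := by
      rw [Real.mul_rpow two_pos.le hs.le, ← mul_assoc, ← Real.rpow_add two_pos]
      ring_nf
      simp
    have h2 : (2 * s) ^ (-(2 * α) - 4) ≤ (τ + ‖x‖) ^ (-(2 * α) - 4) :=
      Real.rpow_le_rpow_of_nonpos (by positivity) hle (by linarith)
    calc K * t * s ^ (-(2 * α) - 4)
        = 2 ^ (2 * α + 4) * K * t * (2 * s) ^ (-(2 * α) - 4) := by rw [h1]; ring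
      _ ≤ _ := by gcongr
  rcases le_or_gt ‖x‖ τ with h | h
  · refine (hC x t ht).trans ?_
    rw [near t ht, ← mul_assoc]
    exact compare hC0 (by linarith) hτ (by linarith)
  · have hx0 : 0 < ‖x‖ := hτ.trans h
    exact (far x t ht (norm_pos_iff.1 hx0)).trans
      (compare hD.le (by linarith) hx0 (by linarith))

end PadicParabolic
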